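/- The graph obtained from the complete graph K_4 by deleting a single edge (the diamond graph, a simple graph on 4 vertices with 5 edges) admits a gap-[4]-vertex-labelling; in particular it is gap-vertex-labelable, and hence the gap-strength of K_4 equals 1. -/

import Mathlib

/-- The neighbourhood of `v` in `G` as a `Finset` (classically decidable). -/
noncomputable def gapNbhd {V : Type*} [Fintype V] (G : SimpleGraph V) (v : V) : Finset V :=
  @Finset.filter V (fun u => G.Adj v u) (Classical.decPred _) Finset.univ

/-- The colouring induced by a vertex-labelling `π` : a vertex with at least two neighbours
gets the gap `max − min` of the labels of its neighbours, a vertex with exactly one neighbour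
`u` gets `π u`, and an isolated vertex gets `1`. -/
noncomputable def gapColor {V : Type*} [Fintype V] (G : SimpleGraph V) (π : V → ℕ) (v : V) : ℕ :=
  if h : ((gapNbhd G v).image π).Nonempty then
    if 2 ≤ (gapNbhd G v).card then
      ((gapNbhd G v).image π).max' h - ((gapNbhd G v).image π).min' h
    else ((gapNbhd G v).image π).max' h
  else 1

/-- `π` is a gap-`[k]`-vertex-labelling of `G`: the labels lie in `{1, …, k}` and the induced
colouring is proper. -/
def IsGapLabelling {V : Type*} [Fintype V] (G : SimpleGraph V) (k : ℕ) (π : V → ℕ) : Prop :=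
  (∀ v, 1 ≤ π v ∧ π v ≤ k) ∧
  ∀ u v, G.Adj u v → gapColor G π u ≠ gapColor G π v

/-- `G` is gap-vertex-labelable if it admits a gap-`[k]`-vertex-labelling for some `k ≥ 1`. -/
def GapVertexLabelable {V : Type*} [Fintype V] (G : SimpleGraph V) : Prop :=
  ∃ k, 1 ≤ k ∧ ∃ π, IsGapLabelling G k π

/-- The vertex-gap number: the least `k ≥ 1` for which `G` admits a
gap-`[k]`-vertex-labelling. -/
noncomputable def vertexGapNumber {V : Type*} [Fintype V] (G : SimpleGraph V) : ℕ :=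
  sInf {k | 1 ≤ k ∧ ∃ π, IsGapLabelling G k π}

/-- The gap-strength of `G`: the least number `l` such that some graph obtained from `G` by
removing `l` edges is gap-vertex-labelable. -/
noncomputable def gapStrength {V : Type*} [Fintype V] (G : SimpleGraph V) : ℕ :=
  sInf {l | ∃ H : SimpleGraph V, H ≤ G ∧ H.edgeSet.ncard + l = G.edgeSet.ncard ∧
    GapVertexLabelable H}

theorem mem_gapNbhd {V : Type*} [Fintype V] {G : SimpleGraph V} {v u : V} :
    u ∈ gapNbhd G v ↔ G.Adj v u := by
  simp [gapNbhd]

/-- The colour of a vertex `v` is `π y - π x` as soon as `x ≠ y` are neighbours of `v` carrying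
the least and the greatest label among the neighbours of `v`. -/
theorem gapColor_eq_sub {V : Type*} [Fintype V] {G : SimpleGraph V} {π : V → ℕ} {v x y : V}
    (hx : G.Adj v x) (hy : G.Adj v y) (hxy : x ≠ y)
    (h : ∀ u, G.Adj v u → π x ≤ π u ∧ π u ≤ π y) :
    gapColor G π v = π y - π x := by
  have hxm : π x ∈ (gapNbhd G v).image π := Finset.mem_image_of_mem π (mem_gapNbhd.2 hx)
  have hym : π y ∈ (gapNbhd G v).image π := Finset.mem_image_of_mem π (mem_gapNbhd.2 hy)
  have hne : ((gapNbhd G v).image π).Nonempty := ⟨_, hxm⟩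
  have hcard : 2 ≤ (gapNbhd G v).card :=
    Finset.one_lt_card.2 ⟨x, mem_gapNbhd.2 hx, y, mem_gapNbhd.2 hy, hxy⟩
  have hmax : ((gapNbhd G v).image π).max' hne = π y := by
    refine le_antisymm (Finset.max'_le _ _ _ fun m hm => ?_) (Finset.le_max' _ _ hym)
    obtain ⟨u, hu, rfl⟩ := Finset.mem_image.1 hm
    exact (h u (mem_gapNbhd.1 hu)).2
  have hmin : ((gapNbhd G v).image π).min' hne = π x := by
    refine le_antisymm (Finset.min'_le _ _ hxm) (Finset.le_min' _ _ _ fun m hm => ?_)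
    obtain ⟨u, hu, rfl⟩ := Finset.mem_image.1 hm
    exact (h u (mem_gapNbhd.1 hu)).1
  rw [gapColor, dif_pos hne, if_pos hcard, hmax, hmin]

theorem isGapLabelling_diamond :
    IsGapLabelling ((⊤ : SimpleGraph (Fin 4)).deleteEdges {s(0, 1)}) 4 ![4, 4, 1, 2] := by
  have adj (u v : Fin 4) : ((⊤ : SimpleGraph (Fin 4)).deleteEdges {s(0, 1)}).Adj u v ↔
      u ≠ v ∧ s(u, v) ≠ s(0, 1) := by
    simp [SimpleGraph.deleteEdges_adj]
  have color {v : Fin 4} (x y : Fin 4)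
      (hxy : (v ≠ x ∧ s(v, x) ≠ s(0, 1)) ∧ (v ≠ y ∧ s(v, y) ≠ s(0, 1)) ∧ x ≠ y)
      (h : ∀ u, v ≠ u ∧ s(v, u) ≠ s(0, 1) →
        ![4, 4, 1, 2] x ≤ ![4, 4, 1, 2] u ∧ ![4, 4, 1, 2] u ≤ ![4, 4, 1, 2] y) :
      gapColor ((⊤ : SimpleGraph (Fin 4)).deleteEdges {s(0, 1)}) ![4, 4, 1, 2] v =
        ![4, 4, 1, 2] y - ![4, 4, 1, 2] x :=
    gapColor_eq_sub ((adj _ _).2 hxy.1) ((adj _ _).2 hxy.2.1) hxy.2.2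
      fun u hu => h u ((adj _ _).1 hu)
  have colors (v : Fin 4) :
      gapColor ((⊤ : SimpleGraph (Fin 4)).deleteEdges {s(0, 1)}) ![4, 4, 1, 2] v =
        ![1, 1, 2, 3] v := by
    fin_cases v
    · exact color 2 3 (by decide) (by decide)
    · exact color 2 3 (by decide) (by decide)
    · exact color 3 0 (by decide) (by decide)
    · exact color 2 0 (by decide) (by decide)
  refine ⟨by decide, fun u v huv => ?_⟩
  rw [adj] at huv
  rw [colors, colors]
  revert u v
  decide

theorem not_gapVertexLabelable_K4 : ¬ GapVertexLabelable (⊤ : SimpleGraph (Fin 4)) := by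
  rintro ⟨k, -, π, -, hπ⟩
  obtain ⟨x, -, hx⟩ := Finset.exists_min_image Finset.univ π Finset.univ_nonempty
  obtain ⟨y, hyx, hy⟩ := Finset.exists_max_image (Finset.univ.erase x) π
    (Finset.card_pos.1 (by simp))
  have hyx' : y ≠ x := Finset.ne_of_mem_erase hyx
  have bounds (u : Fin 4) : π x ≤ π u ∧ π u ≤ π y := by
    refine ⟨hx u (Finset.mem_univ u), ?_⟩
    by_cases hu : u = x
    · exact hu ▸ hx y (Finset.mem_univ y)
    · exact hy u (Finset.mem_erase.2 ⟨hu, Finset.mem_univ u⟩)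
  obtain ⟨a, b, hab, hax, hay, hbx, hby⟩ :
      ∃ a b : Fin 4, a ≠ b ∧ a ≠ x ∧ a ≠ y ∧ b ≠ x ∧ b ≠ y := by
    clear hx hy hyx hyx' bounds hπ
    revert x y
    decide
  refine hπ a b hab ?_
  rw [gapColor_eq_sub (π := π) (x := x) (y := y) hax hay hyx'.symm fun u _ => bounds u,
    gapColor_eq_sub (π := π) (x := x) (y := y) hbx hby hyx'.symm fun u _ => bounds u]

/-- The diamond graph (`K_4` minus one edge) admits a gap-`[4]`-vertex-labelling; in
particular it is gap-vertex-labelable, and hence the gap-strength of `K_4` equals `1`. -/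
theorem gapStrength_K4 :
    (∃ π, IsGapLabelling ((⊤ : SimpleGraph (Fin 4)).deleteEdges {s(0, 1)}) 4 π) ∧
      GapVertexLabelable ((⊤ : SimpleGraph (Fin 4)).deleteEdges {s(0, 1)}) ∧
      gapStrength (⊤ : SimpleGraph (Fin 4)) = 1 := by
  have labelable : GapVertexLabelable ((⊤ : SimpleGraph (Fin 4)).deleteEdges {s(0, 1)}) :=
    ⟨4, by norm_num, _, isGapLabelling_diamond⟩
  have one_mem : 1 ∈ {l | ∃ H : SimpleGraph (Fin 4), H ≤ ⊤ ∧
      H.edgeSet.ncard + l = (⊤ : SimpleGraph (Fin 4)).edgeSet.ncard ∧ GapVertexLabelable H} := by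
    refine ⟨_, le_top, ?_, labelable⟩
    rw [SimpleGraph.edgeSet_deleteEdges]
    exact Set.ncard_sdiff_singleton_add_one (by simp) (Set.toFinite _)
  refine ⟨⟨_, isGapLabelling_diamond⟩, labelable, le_antisymm (Nat.sInf_le one_mem) ?_⟩
  refine le_csInf ⟨1, one_mem⟩ fun l ⟨H, hH, hcard, hlab⟩ => Nat.one_le_iff_ne_zero.2 ?_
  rintro rfl
  have hedge : H.edgeSet = (⊤ : SimpleGraph (Fin 4)).edgeSet :=
    Set.eq_of_subset_of_ncard_le (SimpleGraph.edgeSet_mono hH) hcard.ge (Set.toFinite _)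
  exact not_gapVertexLabelable_K4 (SimpleGraph.edgeSet_injective hedge ▸ hlab)
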